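/- Under the hypotheses of the reduced (u, λ) system with C1 = B0 (i.e. (P1,P2,E1) solves the characteristic system, (p1,p2,e) solves the extended system, p1 ≠ 0, and p2 − B0 = B0(e − 1) on the interval I), the functions u = e/p1 and λ = (e−1)/p1 satisfy on I: du/dθ = M1 u² − 2 M2 u + M3 and dλ/dθ = λ (M1 u − M2), where M1(θ) = 1 + B0²(1+P1²)/γ³, M2(θ) = B0 P1 P2/γ³, M3(θ) = (1+P2²)/γ³; moreover M1(θ) ≥ 1 > 0 for all θ ∈ I. -/

import Mathlib

open Real Set

/-- The Lorentz factor `γ = √(1 + P1² + P2²)` along a characteristic. -/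
noncomputable def gam (P1 P2 : ℝ → ℝ) (θ : ℝ) : ℝ :=
  Real.sqrt (1 + P1 θ ^ 2 + P2 θ ^ 2)

/-- `Q = (p1 P1 + p2 P2)/γ³`. -/
noncomputable def Qv (P1 P2 p1 p2 : ℝ → ℝ) (θ : ℝ) : ℝ :=
  (p1 θ * P1 θ + p2 θ * P2 θ) / (gam P1 P2 θ) ^ 3

/-- `q1 = p1/γ − P1 (p1 P1 + p2 P2)/γ³`. -/
noncomputable def q1v (P1 P2 p1 p2 : ℝ → ℝ) (θ : ℝ) : ℝ :=
  p1 θ / gam P1 P2 θ - P1 θ * Qv P1 P2 p1 p2 θ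

/-- `q2 = p2/γ − P2 (p1 P1 + p2 P2)/γ³`. -/
noncomputable def q2v (P1 P2 p1 p2 : ℝ → ℝ) (θ : ℝ) : ℝ :=
  p2 θ / gam P1 P2 θ - P2 θ * Qv P1 P2 p1 p2 θ

/-- `M1 = 1 + B0²(1 + P1²)/γ³`. -/
noncomputable def M1v (B0 : ℝ) (P1 P2 : ℝ → ℝ) (θ : ℝ) : ℝ :=
  1 + B0 ^ 2 * (1 + P1 θ ^ 2) / (gam P1 P2 θ) ^ 3

/-- `M2 = B0 P1 P2/γ³`. -/
noncomputable def M2v (B0 : ℝ) (P1 P2 : ℝ → ℝ) (θ : ℝ) : ℝ :=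
  B0 * (P1 θ * P2 θ) / (gam P1 P2 θ) ^ 3

/-- `M3 = (1 + P2²)/γ³`. -/
noncomputable def M3v (P1 P2 : ℝ → ℝ) (θ : ℝ) : ℝ :=
  (1 + P2 θ ^ 2) / (gam P1 P2 θ) ^ 3

theorem gam_pos (P1 P2 : ℝ → ℝ) (θ : ℝ) : 0 < gam P1 P2 θ :=
  Real.sqrt_pos.mpr (by positivity)

theorem gam_sq (P1 P2 : ℝ → ℝ) (θ : ℝ) :
    gam P1 P2 θ ^ 2 = 1 + P1 θ ^ 2 + P2 θ ^ 2 :=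
  Real.sq_sqrt (by positivity)

theorem q1v_eq (P1 P2 p1 p2 : ℝ → ℝ) (θ : ℝ) :
    q1v P1 P2 p1 p2 θ =
      (p1 θ * (1 + P2 θ ^ 2) - p2 θ * (P1 θ * P2 θ)) / gam P1 P2 θ ^ 3 := by
  have hγ := (gam_pos P1 P2 θ).ne'
  rw [q1v, Qv]
  field_simp
  rw [gam_sq]
  ring

theorem q2v_eq (P1 P2 p1 p2 : ℝ → ℝ) (θ : ℝ) :
    q2v P1 P2 p1 p2 θ =
      (p2 θ * (1 + P1 θ ^ 2) - p1 θ * (P1 θ * P2 θ)) / gam P1 P2 θ ^ 3 := by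
  have hγ := (gam_pos P1 P2 θ).ne'
  rw [q2v, Qv]
  field_simp
  rw [gam_sq]
  ring

theorem one_le_M1v (B0 : ℝ) (P1 P2 : ℝ → ℝ) (θ : ℝ) : 1 ≤ M1v B0 P1 P2 θ := by
  have hγ := gam_pos P1 P2 θ
  exact le_add_of_nonneg_right (by positivity)

/-- In the case `C1 = B0` (i.e. `p2 − B0 = B0(e − 1)`), the variables `u = e/p1` and
`λ = (e−1)/p1` satisfy `u′ = M1 u² − 2M2 u + M3`, `λ′ = λ(M1 u − M2)`, with `M1 ≥ 1`. -/
theorem u_lambda_system_C1_eq_B0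
    (B0 : ℝ) (I : Set ℝ) (P1 P2 E1 p1 p2 e : ℝ → ℝ)
    (hP1 : ∀ θ ∈ I, HasDerivAt P1 (-(E1 θ) - B0 * P2 θ / gam P1 P2 θ) θ)
    (hP2 : ∀ θ ∈ I, HasDerivAt P2 (B0 * P1 θ / gam P1 P2 θ) θ)
    (hE1 : ∀ θ ∈ I, HasDerivAt E1 (P1 θ / gam P1 P2 θ) θ)
    (hp1 : ∀ θ ∈ I, HasDerivAt p1
      (-(q1v P1 P2 p1 p2 θ) * p1 θ - B0 * q2v P1 P2 p1 p2 θ - e θ) θ)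
    (hp2 : ∀ θ ∈ I, HasDerivAt p2
      (-(q1v P1 P2 p1 p2 θ) * p2 θ + B0 * q1v P1 P2 p1 p2 θ) θ)
    (he : ∀ θ ∈ I, HasDerivAt e ((1 - e θ) * q1v P1 P2 p1 p2 θ) θ)
    (hp1ne : ∀ θ ∈ I, p1 θ ≠ 0)
    (hrel : ∀ θ ∈ I, p2 θ - B0 = B0 * (e θ - 1)) :
    (∀ θ ∈ I, HasDerivAt (fun t => e t / p1 t)
      (M1v B0 P1 P2 θ * (e θ / p1 θ) ^ 2 - 2 * M2v B0 P1 P2 θ * (e θ / p1 θ)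
        + M3v P1 P2 θ) θ) ∧
    (∀ θ ∈ I, HasDerivAt (fun t => (e t - 1) / p1 t)
      ((e θ - 1) / p1 θ * (M1v B0 P1 P2 θ * (e θ / p1 θ) - M2v B0 P1 P2 θ)) θ) ∧
    (∀ θ ∈ I, 1 ≤ M1v B0 P1 P2 θ) := by
  refine ⟨fun θ hθ => ?_, fun θ hθ => ?_, fun θ _ => one_le_M1v B0 P1 P2 θ⟩
  all_goals
    have hp := hp1ne θ hθ
    have hγ := (gam_pos P1 P2 θ).ne'
    have hp2e : p2 θ = B0 * e θ := by linear_combination hrel θ hθ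
  · refine ((he θ hθ).fun_div (hp1 θ hθ) hp).congr_deriv ?_
    rw [M1v, M2v, M3v, q1v_eq, q2v_eq, hp2e]
    field_simp
    ring
  · refine (((he θ hθ).sub_const 1).fun_div (hp1 θ hθ) hp).congr_deriv ?_
    rw [M1v, M2v, q1v_eq, q2v_eq, hp2e]
    field_simp
    ring
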